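/- arXiv:2310.20438 — 4 statements merged into one kernel-verified Lean document; each statement's English description precedes it below -/
import Mathlib

section
/- Let x, y ~ N(0, I_p) be independent standard Gaussian vectors and B a fixed p×m matrix. Then E[‖x‖₂⁴·‖B^T x‖₂²] = (p+2)(p+4)·‖B‖_F². -/
open MeasureTheory ProbabilityTheory Matrix

noncomputable section

lemma gauss_even (k : ℕ) : ∫ x : ℝ, x ^ (2 * k) ∂(gaussianReal 0 1)
    = ((2 * k - 1 : ℕ).doubleFactorial : ℝ) := by
  rw [integral_gaussianReal_eq_integral_smul one_ne_zero]
  have h1 : ∀ x : ℝ, gaussianPDFReal 0 1 x • x ^ (2 * k) =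
      (fun y : ℝ => (√(2 * Real.pi))⁻¹ * (y ^ (2 * k) * Real.exp (-(1/2) * y ^ 2))) |x| := by
    intro x
    simp only [gaussianPDFReal, smul_eq_mul, pow_mul, sq_abs]
    simp only [NNReal.coe_one, sub_zero, mul_one]
    rw [show -x ^ 2 / 2 = -(1/2) * x ^ 2 by ring]
    ring
  rw [integral_congr_ae (Filter.Eventually.of_forall h1),
    integral_comp_abs (f := fun y : ℝ =>
      (√(2 * Real.pi))⁻¹ * (y ^ (2 * k) * Real.exp (-(1/2) * y ^ 2))), integral_const_mul]
  have h2 := integral_rpow_mul_exp_neg_mul_rpow (p := 2) (q := ((2 * k : ℕ) : ℝ)) (b := 1/2)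
    (by norm_num) (by have : (0:ℝ) ≤ ((2 * k : ℕ) : ℝ) := by positivity
                      linarith) (by norm_num)
  simp_rw [Real.rpow_natCast, Real.rpow_two] at h2
  rw [h2]
  have h3 : (((2 * k : ℕ) : ℝ) + 1) / 2 = k + 1 / 2 := by push_cast; ring
  rw [neg_div, h3, Real.Gamma_nat_add_half, Real.rpow_neg (by norm_num),
    Real.rpow_add (by norm_num), Real.rpow_natCast, ← Real.sqrt_eq_rpow,
    Real.sqrt_mul (by norm_num)]
  have hp : √Real.pi ≠ 0 := by positivity
  have h4 : √(1/2 : ℝ) = (√2)⁻¹ := by rw [one_div, Real.sqrt_inv]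
  rw [h4]
  have : √(2:ℝ) ≠ 0 := by positivity
  field_simp
  rw [← mul_pow]; norm_num

lemma gauss_odd (n : ℕ) (hn : Odd n) : ∫ x : ℝ, x ^ n ∂(gaussianReal 0 1) = 0 := by
  have h := gaussianReal_map_neg (μ := 0) (v := 1)
  rw [neg_zero] at h
  have h2 : ∫ x : ℝ, x ^ n ∂(gaussianReal 0 1) = ∫ x : ℝ, (-x) ^ n ∂(gaussianReal 0 1) := by
    conv_lhs => rw [← h]
    rw [integral_map (by fun_prop) (by fun_prop)]
  simp_rw [hn.neg_pow, integral_neg] at h2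
  linarith

lemma gauss_int (n : ℕ) : Integrable (fun x : ℝ => x ^ n) (gaussianReal 0 1) := by
  have h := (memLp_id_gaussianReal (μ := 0) (v := 1) (n : NNReal)).integrable_norm_pow'
  refine (integrable_norm_iff (by fun_prop)).1 ?_
  simpa using h

def cnt {p : ℕ} (a b i k l : Fin p) : ℕ :=
  (if l = a then 2 else 0) + (if l = b then 2 else 0) + (if l = i then 1 else 0)
    + (if l = k then 1 else 0)

lemma mono_eq {p : ℕ} (a b i k : Fin p) (x : Fin p → ℝ) :
    x a ^ 2 * x b ^ 2 * x i * x k = ∏ l, x l ^ cnt a b i k l := by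
  simp only [cnt, pow_add, Finset.prod_mul_distrib]
  simp [pow_ite]

lemma mono_int {p : ℕ} (a b i k : Fin p) :
    Integrable (fun x : Fin p → ℝ => x a ^ 2 * x b ^ 2 * x i * x k)
      (Measure.pi fun _ : Fin p => gaussianReal 0 1) := by
  simp_rw [mono_eq]
  exact Integrable.fintype_prod (f := fun l (y : ℝ) => y ^ cnt a b i k l) (fun l => gauss_int _)

lemma mono_val_ne {p : ℕ} (a b i k : Fin p) (h : i ≠ k) :
    ∫ x : Fin p → ℝ, x a ^ 2 * x b ^ 2 * x i * x k
      ∂(Measure.pi fun _ : Fin p => gaussianReal 0 1) = 0 := by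
  simp_rw [mono_eq]
  rw [integral_fintype_prod_eq_prod (fun l (y : ℝ) => y ^ cnt a b i k l)]
  apply Finset.prod_eq_zero (Finset.mem_univ i)
  apply gauss_odd
  simp only [cnt, if_neg h]
  split_ifs <;> decide

lemma mono_val_eq {p : ℕ} (a b i : Fin p) :
    ∫ x : Fin p → ℝ, x a ^ 2 * x b ^ 2 * x i * x i
      ∂(Measure.pi fun _ : Fin p => gaussianReal 0 1) =
      1 + (if a = b then 2 else 0) + (if a = i then 2 else 0) + (if b = i then 2 else 0)
        + (if a = i then (if b = i then 8 else 0) else 0) := by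
  simp_rw [mono_eq]
  rw [integral_fintype_prod_eq_prod (fun l (y : ℝ) => y ^ cnt a b i i l)]
  have g0 := gauss_even 0
  have g1 := gauss_even 1
  have g2 := gauss_even 2
  have g3 := gauss_even 3
  norm_num [Nat.doubleFactorial] at g0 g1 g2 g3
  rw [← Finset.prod_subset (Finset.subset_univ {a, b, i})]
  · by_cases hab : a = b
    · subst hab
      by_cases hai : a = i
      · subst hai
        simp [cnt, g3]; norm_num
      · have := Ne.symm hai
        simp [cnt, g1, g2, hai, this]; norm_num
    · have hab' := Ne.symm hab
      by_cases hai : a = i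
      · subst hai
        simp [cnt, g1, g2, hab, hab']; norm_num
      · have hai' := Ne.symm hai
        by_cases hbi : b = i
        · subst hbi
          simp [cnt, g1, g2, hab, hab']; norm_num
        · have hbi' := Ne.symm hbi
          simp [cnt, g1, hab, hab', hai, hai', hbi, hbi']
  · intro l _ hl
    simp only [Finset.mem_insert, Finset.mem_singleton, not_or] at hl
    simp [cnt, hl.1, hl.2.1, hl.2.2]

theorem statement9 (p m : ℕ) (B : Matrix (Fin p) (Fin m) ℝ) :
    ∫ x : Fin p → ℝ,
      (∑ i, x i ^ 2) ^ 2 * (∑ j, (Bᵀ.mulVec x j) ^ 2)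
      ∂(Measure.pi fun _ : Fin p => gaussianReal 0 1)
    = ((p : ℝ) + 2) * ((p : ℝ) + 4) * ∑ i, ∑ j, B i j ^ 2 := by
  have hexp : ∀ x : Fin p → ℝ, (∑ i, x i ^ 2) ^ 2 * (∑ j, (Bᵀ.mulVec x j) ^ 2)
      = ∑ j, ∑ i, ∑ k, ∑ a, ∑ b, (B i j * B k j) * (x a ^ 2 * x b ^ 2 * x i * x k) := by
    intro x
    rw [Finset.mul_sum]
    refine Finset.sum_congr rfl fun j _ => ?_
    simp only [Matrix.mulVec, dotProduct, Matrix.transpose_apply]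
    rw [sq (∑ i, B i j * x i), Finset.sum_mul_sum, Finset.mul_sum]
    refine Finset.sum_congr rfl fun i _ => ?_
    rw [Finset.mul_sum]
    refine Finset.sum_congr rfl fun k _ => ?_
    rw [sq, Finset.sum_mul_sum, Finset.sum_mul]
    refine Finset.sum_congr rfl fun a _ => ?_
    rw [Finset.sum_mul]
    refine Finset.sum_congr rfl fun b _ => ?_
    ring
  simp_rw [hexp]
  have hI : ∀ (j : Fin m) (i k a b : Fin p), Integrable
      (fun x : Fin p → ℝ => (B i j * B k j) * (x a ^ 2 * x b ^ 2 * x i * x k))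
      (Measure.pi fun _ : Fin p => gaussianReal 0 1) :=
    fun j i k a b => (mono_int a b i k).const_mul _
  rw [integral_finsetSum _ fun j _ => integrable_finsetSum _ fun i _ => integrable_finsetSum _
    fun k _ => integrable_finsetSum _ fun a _ => integrable_finsetSum _ fun b _ => hI j i k a b]
  rw [Finset.sum_comm (f := fun i j => B i j ^ 2)]
  rw [Finset.mul_sum]
  refine Finset.sum_congr rfl fun j _ => ?_
  rw [integral_finsetSum _ fun i _ => integrable_finsetSum _
    fun k _ => integrable_finsetSum _ fun a _ => integrable_finsetSum _ fun b _ => hI j i k a b]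
  rw [Finset.mul_sum]
  refine Finset.sum_congr rfl fun i _ => ?_
  rw [integral_finsetSum _
    fun k _ => integrable_finsetSum _ fun a _ => integrable_finsetSum _ fun b _ => hI j i k a b]
  have hk : ∀ k, ∫ x : Fin p → ℝ, ∑ a, ∑ b, (B i j * B k j) * (x a ^ 2 * x b ^ 2 * x i * x k)
      ∂(Measure.pi fun _ : Fin p => gaussianReal 0 1) =
      ∑ a, ∑ b, (B i j * B k j) * ∫ x : Fin p → ℝ, (x a ^ 2 * x b ^ 2 * x i * x k)
      ∂(Measure.pi fun _ : Fin p => gaussianReal 0 1) := by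
    intro k
    rw [integral_finsetSum _ fun a _ => integrable_finsetSum _ fun b _ => hI j i k a b]
    refine Finset.sum_congr rfl fun a _ => ?_
    rw [integral_finsetSum _ fun b _ => hI j i k a b]
    simp_rw [integral_const_mul]
  simp_rw [hk]
  rw [Finset.sum_eq_single i]
  · simp_rw [mono_val_eq, ← Finset.mul_sum]
    simp [Finset.sum_add_distrib, Finset.sum_ite_eq, ← Finset.sum_mul, ← Finset.mul_sum]
    ring
  · intro k _ hk'
    simp [mono_val_ne _ _ i k (Ne.symm hk')]
  · simp
end
end

section
/- Let x, y ~ N(0, I_p) be independent standard Gaussian vectors, w ~ N(0, I_m) independent of x and y, σ ≥ 0, and B a fixed p×m matrix with singular values λ₁,…,λ_r (r = rank B). Define Ξ = x^T B B^T (x − y) + σ·w^T B^T (x − y). If for every i, θ²σ²λ_i² < 1 and θ²λ_i²(λ_i² + 2σ²) ≤ 1 + 2θλ_i², then E[e^{−θΞ}] = ∏_{i=1}^r (1 + 2θλ_i² − θ²λ_i²(λ_i² + 2σ²))^{−1/2}. -/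
open MeasureTheory ProbabilityTheory Matrix

noncomputable section

lemma aux_lintegral_pi {r : ℕ} (μ : Measure ℝ) [IsProbabilityMeasure μ]
    (f : Fin r → ℝ → ENNReal) (hf : ∀ i, Measurable (f i)) :
    ∫⁻ x, ∏ i, f i (x i) ∂(Measure.pi fun _ : Fin r => μ) = ∏ i, ∫⁻ t, f i t ∂μ := by
  have h := lintegral_prod_eq_prod_lintegral_of_indepFun
    (μ := Measure.pi fun _ : Fin r => μ) Finset.univ (fun i x => f i (x i))
    (iIndepFun_pi (fun i => (hf i).aemeasurable))
    (fun i => (hf i).comp (measurable_pi_apply i))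
  rw [h]
  refine Finset.prod_congr rfl fun i _ => ?_
  exact (measurePreserving_eval (fun _ : Fin r => μ) i).lintegral_comp (hf i)

lemma aux_charFunDual (l : StrongDual ℝ ℝ) :
    charFunDual (gaussianReal 0 1) l = Complex.exp (-((l 1 : ℝ) : ℂ) ^ 2 / 2) := by
  have h : charFunDual (gaussianReal 0 1) l = charFun (gaussianReal 0 1) (l 1) := by
    rw [charFunDual_apply, charFun_apply_real]
    congr 1; ext x
    have : l x = l 1 * x := by
      have := l.map_smul x 1
      simpa [mul_comm] using this
    rw [this]; push_cast; ring_nf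
  rw [h, charFun_gaussianReal]
  congr 1
  push_cast
  ring

def auxL {p r : ℕ} (u : Fin r → Fin p → ℝ) : (Fin p → ℝ) →L[ℝ] (Fin r → ℝ) :=
  LinearMap.toContinuousLinearMap (Matrix.mulVecLin (Matrix.of u))

lemma auxL_apply {p r : ℕ} (u : Fin r → Fin p → ℝ) (x : Fin p → ℝ) (i : Fin r) :
    auxL u x i = u i ⬝ᵥ x := rfl

lemma aux_map {p r : ℕ} (u : Fin r → Fin p → ℝ)
    (hu : ∀ i j, u i ⬝ᵥ u j = if i = j then (1 : ℝ) else 0) :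
    (Measure.pi fun _ : Fin p => gaussianReal 0 1).map (auxL u)
      = Measure.pi fun _ : Fin r => gaussianReal 0 1 := by
  have : IsProbabilityMeasure ((Measure.pi fun _ : Fin p => gaussianReal 0 1).map (auxL u)) :=
    Measure.isProbabilityMeasure_map (by fun_prop)
  apply Measure.ext_of_charFunDual
  ext l
  rw [charFunDual_map, charFunDual_pi, charFunDual_pi]
  simp_rw [aux_charFunDual, ← Complex.exp_sum]
  congr 1
  have key : ∀ x : Fin r → ℝ, l x = ∑ i, x i * l (Pi.single i 1) := by
    intro x
    conv_lhs => rw [pi_eq_sum_univ' x]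
    simp [map_sum]
  have h1 : ∀ j : Fin p, l (auxL u (Pi.single j 1)) = ∑ i, u i j * l (Pi.single i 1) := by
    intro j
    rw [key]
    simp [auxL_apply]
  have h2 : ∑ j : Fin p, (l (auxL u (Pi.single j 1))) ^ 2 = ∑ i, (l (Pi.single i 1)) ^ 2 := by
    simp_rw [h1, sq, Finset.sum_mul_sum]
    rw [Finset.sum_comm]
    refine Finset.sum_congr rfl fun i _ => ?_
    rw [Finset.sum_comm]
    have : ∀ k, ∑ j, u i j * l (Pi.single i 1) * (u k j * l (Pi.single k 1))
        = (u i ⬝ᵥ u k) * (l (Pi.single i 1) * l (Pi.single k 1)) := by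
      intro k
      rw [dotProduct, Finset.sum_mul]
      exact Finset.sum_congr rfl fun j _ => by ring
    simp_rw [this, hu]
    simp
  have h3 : ∑ j : Fin p, -(((l (auxL u (Pi.single j 1)) : ℝ) : ℂ)) ^ 2 / 2
      = ∑ i, -((l (Pi.single i 1) : ℝ) : ℂ) ^ 2 / 2 := by
    rw [← Finset.sum_div, ← Finset.sum_div, Finset.sum_neg_distrib, Finset.sum_neg_distrib]
    exact_mod_cast congrArg (fun t : ℝ => -(t : ℂ) / 2) h2
  simpa using h3

lemma aux_gauss (α β : ℝ) (hβ : β < 1) :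
    ∫⁻ x, ENNReal.ofReal (Real.exp (α * x + β * x ^ 2 / 2)) ∂(gaussianReal 0 1)
      = ENNReal.ofReal ((1 - β) ^ (-(1 : ℝ) / 2) * Real.exp (α ^ 2 / (2 * (1 - β)))) := by
  have hpos : 0 < 1 - β := by linarith
  rw [gaussianReal_of_var_ne_zero _ one_ne_zero,
    lintegral_withDensity_eq_lintegral_mul _ (measurable_gaussianPDF 0 1) (by fun_prop)]
  let v : NNReal := ⟨(1 - β)⁻¹, by positivity⟩
  have hv : v ≠ 0 := by
    intro h
    have : (v : ℝ) = 0 := by rw [h]; rfl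
    have h2 : (1 - β)⁻¹ = 0 := this
    simp at h2; linarith
  have hpt : ∀ x, (gaussianPDF 0 1 * fun x => ENNReal.ofReal (Real.exp (α * x + β * x ^ 2 / 2))) x
      = ENNReal.ofReal ((1 - β) ^ (-(1 : ℝ) / 2) * Real.exp (α ^ 2 / (2 * (1 - β))))
        * gaussianPDF (α / (1 - β)) v x := by
    intro x
    simp only [Pi.mul_apply, gaussianPDF]
    rw [← ENNReal.ofReal_mul (gaussianPDFReal_nonneg _ _ _), ← ENNReal.ofReal_mul (by positivity)]
    congr 1
    simp only [gaussianPDFReal]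
    have hvv : (v : ℝ) = (1 - β)⁻¹ := rfl
    rw [hvv]
    have e1 : (1 - β) ^ (-(1 : ℝ) / 2) = (√(1 - β))⁻¹ := by
      rw [neg_div, Real.rpow_neg hpos.le, Real.sqrt_eq_rpow]
    have e2 : √(2 * Real.pi * (1 - β)⁻¹) = √(2 * Real.pi) * (√(1 - β))⁻¹ := by
      rw [Real.sqrt_mul (by positivity), Real.sqrt_inv]
    rw [e1, e2]
    have hs : √(1 - β) ≠ 0 := (Real.sqrt_pos.2 hpos).ne'
    have e3 : Real.exp (-(x - 0) ^ 2 / (2 * ((1 : NNReal) : ℝ))) * Real.exp (α * x + β * x ^ 2 / 2)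
        = Real.exp (α ^ 2 / (2 * (1 - β)))
          * Real.exp (-(x - α / (1 - β)) ^ 2 / (2 * (1 - β)⁻¹)) := by
      rw [← Real.exp_add, ← Real.exp_add]
      congr 1
      have := hpos.ne'
      push_cast
      field_simp
      ring
    rw [mul_assoc, e3]
    push_cast
    field_simp
  simp_rw [hpt]
  rw [lintegral_const_mul _ (measurable_gaussianPDF _ _), lintegral_gaussianPDF_eq_one _ hv, mul_one]

lemma aux_gauss_top :
    ∫⁻ x, ENNReal.ofReal (Real.exp (1 * x ^ 2 / 2)) ∂(gaussianReal 0 1) = ⊤ := by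
  rw [gaussianReal_of_var_ne_zero _ one_ne_zero,
    lintegral_withDensity_eq_lintegral_mul _ (measurable_gaussianPDF 0 1) (by fun_prop)]
  have hpt : ∀ x, (gaussianPDF 0 1 * fun x => ENNReal.ofReal (Real.exp (1 * x ^ 2 / 2))) x
      = ENNReal.ofReal (√(2 * Real.pi))⁻¹ := by
    intro x
    simp only [Pi.mul_apply, gaussianPDF]
    rw [← ENNReal.ofReal_mul (gaussianPDFReal_nonneg _ _ _)]
    congr 1
    simp only [gaussianPDFReal]
    rw [mul_assoc, ← Real.exp_add]
    simp
    ring_nf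
    simp
  simp_rw [hpt]
  rw [lintegral_const]
  simp [ENNReal.mul_top, Real.pi_pos]

def auxg (θ σ l a b c : ℝ) : ℝ := Real.exp (-θ * (l ^ 2 * (a * (a - b)) + σ * (l * (c * (a - b)))))

lemma auxg_nonneg (θ σ l a b c : ℝ) : 0 ≤ auxg θ σ l a b c := (Real.exp_pos _).le

lemma aux_factor (θ σ l : ℝ) (hc1 : θ ^ 2 * σ ^ 2 * l ^ 2 < 1)
    (hc2 : θ ^ 2 * l ^ 2 * (l ^ 2 + 2 * σ ^ 2) ≤ 1 + 2 * θ * l ^ 2) :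
    (∫⁻ a, ∫⁻ b, ∫⁻ c, ENNReal.ofReal (auxg θ σ l a b c) ∂(gaussianReal 0 1)
      ∂(gaussianReal 0 1) ∂(gaussianReal 0 1)).toReal
    = (1 + 2 * θ * l ^ 2 - θ ^ 2 * l ^ 2 * (l ^ 2 + 2 * σ ^ 2)) ^ (-(1 : ℝ) / 2) := by
  set D := 1 + 2 * θ * l ^ 2 - θ ^ 2 * l ^ 2 * (l ^ 2 + 2 * σ ^ 2) with hD
  have hD0 : 0 ≤ D := by linarith
  set s := θ ^ 2 * σ ^ 2 * l ^ 2 with hs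
  set t := θ * l ^ 2 with ht
  have hDst : D = 1 + 2 * t - t ^ 2 - 2 * s := by rw [hD, hs, ht]; ring
  have h1s : 0 < 1 - s := by linarith
  have hc : ∀ a b, ∫⁻ c, ENNReal.ofReal (auxg θ σ l a b c) ∂(gaussianReal 0 1)
      = ENNReal.ofReal (Real.exp (-t * a ^ 2 + s * a ^ 2 / 2))
        * ENNReal.ofReal (Real.exp ((t - s) * a * b + s * b ^ 2 / 2)) := by
    intro a b
    have : ∀ c, ENNReal.ofReal (auxg θ σ l a b c)
        = ENNReal.ofReal (Real.exp (-t * (a * (a - b)))) *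
          ENNReal.ofReal (Real.exp ((-θ * σ * l * (a - b)) * c + 0 * c ^ 2 / 2)) := by
      intro c
      rw [← ENNReal.ofReal_mul (by positivity), ← Real.exp_add, auxg]
      congr 2
      rw [ht]; ring
    simp_rw [this]
    rw [lintegral_const_mul _ (by fun_prop), aux_gauss _ _ (by norm_num),
      ← ENNReal.ofReal_mul (by positivity), ← ENNReal.ofReal_mul (by positivity)]
    congr 1
    rw [sub_zero, Real.one_rpow, one_mul, ← Real.exp_add, ← Real.exp_add]
    congr 1
    rw [hs, ht]; ring
  simp_rw [hc]
  have hb : ∀ a, ∫⁻ b, ENNReal.ofReal (Real.exp (-t * a ^ 2 + s * a ^ 2 / 2))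
        * ENNReal.ofReal (Real.exp ((t - s) * a * b + s * b ^ 2 / 2)) ∂(gaussianReal 0 1)
      = ENNReal.ofReal ((1 - s) ^ (-(1 : ℝ) / 2)) *
        ENNReal.ofReal (Real.exp ((1 - D / (1 - s)) * a ^ 2 / 2)) := by
    intro a
    rw [lintegral_const_mul _ (by fun_prop), aux_gauss _ _ (by linarith),
      ← ENNReal.ofReal_mul (by positivity), ← ENNReal.ofReal_mul (by positivity)]
    congr 1
    rw [mul_left_comm, ← Real.exp_add]
    congr 2
    rw [hDst]
    have := h1s.ne'
    field_simp
    ring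
  simp_rw [hb]
  rw [lintegral_const_mul _ (by fun_prop), ENNReal.toReal_mul]
  rcases hD0.eq_or_lt with h0 | h0
  · rw [← h0, zero_div, sub_zero, aux_gauss_top]
    rw [Real.zero_rpow (by norm_num)]
    simp
  · have hq : 0 < D / (1 - s) := by positivity
    have h := aux_gauss 0 (1 - D / (1 - s)) (by linarith)
    simp only [zero_mul, zero_add] at h
    rw [sub_sub_cancel] at h
    rw [h, ENNReal.toReal_ofReal (by positivity), ENNReal.toReal_ofReal (by positivity)]
    norm_num only [zero_pow, zero_div, Real.exp_zero, mul_one]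
    rw [← Real.mul_rpow h1s.le hq.le]
    congr 1
    field_simp

lemma aux_quad {p m r : ℕ} (B : Matrix (Fin p) (Fin m) ℝ)
    (u : Fin r → Fin p → ℝ) (v : Fin r → Fin m → ℝ) (lam : Fin r → ℝ)
    (hv : ∀ i j, v i ⬝ᵥ v j = if i = j then (1 : ℝ) else 0)
    (hB : B = ∑ i, lam i • vecMulVec (u i) (v i)) (x d : Fin p → ℝ) (w : Fin m → ℝ) (σ : ℝ) :
    x ⬝ᵥ (B * Bᵀ).mulVec d + σ * (w ⬝ᵥ Bᵀ.mulVec d)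
    = ∑ i, (lam i ^ 2 * ((u i ⬝ᵥ x) * (u i ⬝ᵥ d)) + σ * (lam i * ((v i ⬝ᵥ w) * (u i ⬝ᵥ d)))) := by
  have hT : ∀ z : Fin p → ℝ, Bᵀ.mulVec z = ∑ i, (lam i * (u i ⬝ᵥ z)) • v i := by
    intro z
    rw [hB, Matrix.transpose_sum, Matrix.sum_mulVec]
    refine Finset.sum_congr rfl fun i _ => ?_
    ext k
    simp [Matrix.mulVec, dotProduct, vecMulVec_apply, Finset.mul_sum, Finset.sum_mul]
    exact Finset.sum_congr rfl fun j _ => by ring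
  rw [← Matrix.mulVec_mulVec, Matrix.dotProduct_mulVec, ← Matrix.mulVec_transpose, hT, hT,
    Finset.sum_add_distrib]
  congr 1
  · simp only [sum_dotProduct, dotProduct_sum, smul_dotProduct, dotProduct_smul, hv, smul_eq_mul]
    refine Finset.sum_congr rfl fun i _ => ?_
    simp
    ring
  · simp only [dotProduct_sum, dotProduct_smul, smul_eq_mul, Finset.mul_sum]
    refine Finset.sum_congr rfl fun i _ => ?_
    rw [dotProduct_comm w]
    ring

theorem statement10 (p m r : ℕ) (B : Matrix (Fin p) (Fin m) ℝ)
    (u : Fin r → Fin p → ℝ) (v : Fin r → Fin m → ℝ) (lam : Fin r → ℝ)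
    (hu : ∀ i j, u i ⬝ᵥ u j = if i = j then (1 : ℝ) else 0)
    (hv : ∀ i j, v i ⬝ᵥ v j = if i = j then (1 : ℝ) else 0)
    (hlam : ∀ i, 0 < lam i)
    (hB : B = ∑ i, lam i • vecMulVec (u i) (v i))
    (θ σ : ℝ) (hθ : 0 < θ) (hσ : 0 ≤ σ)
    (hc1 : ∀ i, θ ^ 2 * σ ^ 2 * lam i ^ 2 < 1)
    (hc2 : ∀ i, θ ^ 2 * lam i ^ 2 * (lam i ^ 2 + 2 * σ ^ 2)
        ≤ 1 + 2 * θ * lam i ^ 2) :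
    ∫ z : (Fin p → ℝ) × (Fin p → ℝ) × (Fin m → ℝ),
      Real.exp (-θ * (z.1 ⬝ᵥ (B * Bᵀ).mulVec (z.1 - z.2.1)
        + σ * (z.2.2 ⬝ᵥ Bᵀ.mulVec (z.1 - z.2.1))))
      ∂((Measure.pi fun _ : Fin p => gaussianReal 0 1).prod
        ((Measure.pi fun _ : Fin p => gaussianReal 0 1).prod
          (Measure.pi fun _ : Fin m => gaussianReal 0 1)))
    = ∏ i, (1 + 2 * θ * lam i ^ 2
        - θ ^ 2 * lam i ^ 2 * (lam i ^ 2 + 2 * σ ^ 2)) ^ (-(1 : ℝ) / 2) := by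
  have hpt : ∀ z : (Fin p → ℝ) × (Fin p → ℝ) × (Fin m → ℝ),
      Real.exp (-θ * (z.1 ⬝ᵥ (B * Bᵀ).mulVec (z.1 - z.2.1)
        + σ * (z.2.2 ⬝ᵥ Bᵀ.mulVec (z.1 - z.2.1))))
      = ∏ i, auxg θ σ (lam i) (auxL u z.1 i) (auxL u z.2.1 i) (auxL v z.2.2 i) := by
    intro z
    rw [aux_quad B u v lam hv hB, Finset.mul_sum, Real.exp_sum]
    refine Finset.prod_congr rfl fun i _ => ?_
    simp only [auxg, auxL_apply, dotProduct_sub]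
  simp_rw [hpt]
  have hgc : ∀ l, Continuous fun q : ℝ × ℝ × ℝ => auxg θ σ l q.1 q.2.1 q.2.2 := by
    intro l; unfold auxg; fun_prop
  let G : (Fin r → ℝ) × (Fin r → ℝ) × (Fin r → ℝ) → ENNReal :=
    fun q => ∏ i, ENNReal.ofReal (auxg θ σ (lam i) (q.1 i) (q.2.1 i) (q.2.2 i))
  have hG : Measurable G := by
    unfold G auxg
    fun_prop
  rw [integral_eq_lintegral_of_nonneg_ae
    (ae_of_all _ fun z => Finset.prod_nonneg fun i _ => auxg_nonneg _ _ _ _ _ _)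
    (by unfold auxg; exact Continuous.aestronglyMeasurable (by fun_prop))]
  have h1 : ∀ z : (Fin p → ℝ) × (Fin p → ℝ) × (Fin m → ℝ), ENNReal.ofReal
      (∏ i, auxg θ σ (lam i) (auxL u z.1 i) (auxL u z.2.1 i) (auxL v z.2.2 i))
      = G (Prod.map (auxL u) (Prod.map (auxL u) (auxL v)) z) := by
    intro z
    rw [ENNReal.ofReal_prod_of_nonneg fun i _ => auxg_nonneg _ _ _ _ _ _]
    rfl
  simp_rw [h1]
  have hLu : Measurable (auxL u) := by fun_prop
  have hLv : Measurable (auxL v) := by fun_prop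
  rw [← lintegral_map hG (hLu.prodMap (hLu.prodMap hLv)),
    ← Measure.map_prod_map _ _ hLu (hLu.prodMap hLv),
    ← Measure.map_prod_map _ _ hLu hLv, aux_map u hu, aux_map v hv,
    lintegral_prod _ hG.aemeasurable]
  have h2 : ∀ a : Fin r → ℝ, ∫⁻ y, G (a, y) ∂((Measure.pi fun _ : Fin r => gaussianReal 0 1).prod
          (Measure.pi fun _ : Fin r => gaussianReal 0 1))
      = ∏ i, ∫⁻ b, ∫⁻ c, ENNReal.ofReal (auxg θ σ (lam i) (a i) b c) ∂(gaussianReal 0 1)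
      ∂(gaussianReal 0 1) := by
    intro a
    rw [lintegral_prod (fun y => G (a, y)) (hG.comp measurable_prodMk_left).aemeasurable]
    have h3 : ∀ b : Fin r → ℝ, ∫⁻ c, G (a, b, c) ∂(Measure.pi fun _ : Fin r => gaussianReal 0 1)
        = ∏ i, ∫⁻ c, ENNReal.ofReal (auxg θ σ (lam i) (a i) (b i) c) ∂(gaussianReal 0 1) := by
      intro b
      exact aux_lintegral_pi _ (fun i c => ENNReal.ofReal (auxg θ σ (lam i) (a i) (b i) c))
        (fun i => by unfold auxg; fun_prop)
    simp_rw [h3]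
    refine aux_lintegral_pi _ (fun i b => ∫⁻ c, ENNReal.ofReal (auxg θ σ (lam i) (a i) b c)
      ∂(gaussianReal 0 1)) (fun i => Measurable.lintegral_prod_right'
        (f := fun q : ℝ × ℝ => ENNReal.ofReal (auxg θ σ (lam i) (a i) q.1 q.2)) ?_)
    unfold auxg; fun_prop
  simp_rw [h2]
  rw [aux_lintegral_pi _ (fun i a => ∫⁻ b, ∫⁻ c, ENNReal.ofReal (auxg θ σ (lam i) a b c)
    ∂(gaussianReal 0 1) ∂(gaussianReal 0 1)), ENNReal.toReal_prod]
  · exact Finset.prod_congr rfl fun i _ => aux_factor θ σ (lam i) (hc1 i) (hc2 i)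
  · intro i
    refine Measurable.lintegral_prod_right' (f := fun q : ℝ × ℝ =>
      ∫⁻ c, ENNReal.ofReal (auxg θ σ (lam i) q.1 q.2 c) ∂(gaussianReal 0 1)) ?_
    refine Measurable.lintegral_prod_right' (f := fun q : (ℝ × ℝ) × ℝ =>
      ENNReal.ofReal (auxg θ σ (lam i) q.1.1 q.1.2 q.2)) ?_
    unfold auxg; fun_prop
end
end

section
/- Let x, y ~ N(0, I_p) be independent standard Gaussian vectors, w ~ N(0, I_m) independent of both, σ ≥ 0, θ > 0, and B a fixed p×m matrix. Define Ξ = x^T B B^T (x − y) + σ·w^T B^T (x − y). Whenever E[e^{−θΞ}] is finite, log E[e^{−θΞ}] ≥ (θ²/2)·(‖B^T B‖_F² + 2σ²‖B‖_F²) − θ‖B‖_F². -/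
open MeasureTheory ProbabilityTheory Matrix

noncomputable section

lemma gauss_pi_exp {n : ℕ} (a : Fin n → ℝ) :
    ∫ v, Real.exp (a ⬝ᵥ v) ∂(Measure.pi fun _ : Fin n => gaussianReal 0 1)
      = Real.exp (a ⬝ᵥ a / 2) := by
  have h1 : ∀ v : Fin n → ℝ, Real.exp (a ⬝ᵥ v) = ∏ i, Real.exp (a i * v i) := by
    intro v; rw [dotProduct, Real.exp_sum]
  simp_rw [h1]
  rw [integral_fintype_prod_eq_prod (f := fun i (t : ℝ) => Real.exp (a i * t))]
  have h2 : ∀ i, ∫ t, Real.exp (a i * t) ∂(gaussianReal 0 1) = Real.exp (a i * a i / 2) := by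
    intro i
    have := mgf_gaussianReal (p := gaussianReal 0 1) (X := id) (μ := 0) (v := 1) (by simp) (a i)
    simp only [mgf, id] at this
    rw [this]; congr 1; simp; ring
  simp_rw [h2]
  rw [← Real.exp_sum, dotProduct, Finset.sum_div]

lemma gauss_pi_sq {n : ℕ} (a : Fin n → ℝ) :
    Integrable (fun v => (a ⬝ᵥ v) ^ 2) (Measure.pi fun _ : Fin n => gaussianReal 0 1) ∧
    ∫ v, (a ⬝ᵥ v) ^ 2 ∂(Measure.pi fun _ : Fin n => gaussianReal 0 1) = ∑ i, a i ^ 2 := by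
  have hm : ∀ i : Fin n, MemLp (fun t : ℝ => a i * t) 2 (gaussianReal 0 1) := fun i =>
    (memLp_id_gaussianReal' 2 (by simp)).const_mul (a i)
  have hm' : ∀ i : Fin n, MemLp (fun v : Fin n → ℝ => a i * v i) 2
      (Measure.pi fun _ : Fin n => gaussianReal 0 1) := fun i =>
    (hm i).comp_measurePreserving (measurePreserving_eval (fun _ : Fin n => gaussianReal 0 1) i)
  have hL : MemLp (fun v => a ⬝ᵥ v) 2 (Measure.pi fun _ : Fin n => gaussianReal 0 1) :=
    memLp_finsetSum _ (fun i _ => hm' i)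
  refine ⟨hL.integrable_sq, ?_⟩
  have hv := variance_sum_pi (μ := fun _ : Fin n => gaussianReal 0 1)
    (X := fun i t => a i * t) hm
  have he : (∑ i, fun ω : Fin n → ℝ => a i * ω i) = fun v => a ⬝ᵥ v := by
    ext v; simp [dotProduct]
  have h0 : ∫ v, a ⬝ᵥ v ∂(Measure.pi fun _ : Fin n => gaussianReal 0 1) = 0 := by
    simp only [dotProduct]
    rw [integral_finsetSum _ (fun i _ => (hm' i).integrable (by norm_num))]
    refine Finset.sum_eq_zero fun i _ => ?_
    rw [integral_const_mul, integral_comp_eval (μ := fun _ : Fin n => gaussianReal 0 1)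
      (f := fun t : ℝ => t) (by fun_prop)]
    simp [integral_id_gaussianReal]
  rw [he, variance_of_integral_eq_zero hL.aestronglyMeasurable.aemeasurable h0] at hv
  rw [hv]
  refine Finset.sum_congr rfl fun i _ => ?_
  rw [variance_const_mul, variance_fun_id_gaussianReal]; simp

lemma gauss_pi_quad {n k : ℕ} (C : Matrix (Fin k) (Fin n) ℝ) :
    Integrable (fun v => C *ᵥ v ⬝ᵥ C *ᵥ v) (Measure.pi fun _ : Fin n => gaussianReal 0 1) ∧
    ∫ v, C *ᵥ v ⬝ᵥ C *ᵥ v ∂(Measure.pi fun _ : Fin n => gaussianReal 0 1)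
      = ∑ i, ∑ j, C i j ^ 2 := by
  have h : ∀ v : Fin n → ℝ, C *ᵥ v ⬝ᵥ C *ᵥ v = ∑ i, (C i ⬝ᵥ v) ^ 2 := by
    intro v; simp [dotProduct, mulVec, sq]
  simp_rw [h]
  refine ⟨integrable_finsetSum _ fun i _ => (gauss_pi_sq (C i)).1, ?_⟩
  rw [integral_finsetSum _ fun i _ => (gauss_pi_sq (C i)).1]
  exact Finset.sum_congr rfl fun i _ => (gauss_pi_sq (C i)).2

instance gauss_pi_isGaussian {n : ℕ} :
    IsGaussian (Measure.pi fun _ : Fin n => gaussianReal 0 1) := by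
  have := (iIndepFun_pi (μ := fun _ : Fin n => gaussianReal 0 1) (X := fun _ => id)
    (fun i => by fun_prop)).hasGaussianLaw (fun i => ⟨by
      simp only [id]
      rw [(measurePreserving_eval (fun _ : Fin n => gaussianReal 0 1) i).map_eq]
      infer_instance⟩)
  have h := this.isGaussian_map
  simp only [id] at h
  rwa [show (fun ω : Fin n → ℝ => fun i => ω i) = id from rfl, Measure.map_id] at h

lemma gauss_rot {n : ℕ} (t : ℝ) :
    MeasurePreserving (ContinuousLinearMap.rotation t)
      ((Measure.pi fun _ : Fin n => gaussianReal 0 1).prod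
        (Measure.pi fun _ : Fin n => gaussianReal 0 1))
      ((Measure.pi fun _ : Fin n => gaussianReal 0 1).prod
        (Measure.pi fun _ : Fin n => gaussianReal 0 1)) := by
  refine ⟨by fun_prop, IsGaussian.map_rotation_eq_self ?_ t⟩
  ext i
  have hi : ∀ i, Integrable (fun v : Fin n → ℝ => v i)
      (Measure.pi fun _ : Fin n => gaussianReal 0 1) := fun i =>
    integrable_comp_eval (μ := fun _ : Fin n => gaussianReal 0 1) (f := fun t : ℝ => t)
      ((memLp_id_gaussianReal' 1 (by simp)).integrable le_rfl)
  simp only [id]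
  rw [eval_integral hi]
  rw [integral_comp_eval (μ := fun _ : Fin n => gaussianReal 0 1)
      (f := fun t : ℝ => t) (by fun_prop)]
  simp [integral_id_gaussianReal]

lemma quad_id {p m : ℕ} (B : Matrix (Fin p) (Fin m) ℝ) (σ θ c : ℝ) (hc : c * c = 1 / 2)
    (u v : Fin p → ℝ) (w : Fin m → ℝ) :
    -θ * ((c • u + c • v) ⬝ᵥ (B * Bᵀ) *ᵥ ((c • u + c • v) - (-c • u + c • v))
      + σ * (w ⬝ᵥ Bᵀ *ᵥ ((c • u + c • v) - (-c • u + c • v))))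
    = -θ * (Bᵀ *ᵥ u ⬝ᵥ Bᵀ *ᵥ u) + ((-θ) • ((B * Bᵀ) *ᵥ u) ⬝ᵥ v
      + (-(2 * θ * σ * c)) • (Bᵀ *ᵥ u) ⬝ᵥ w) := by
  have h1 : (c • u + c • v) - (-c • u + c • v) = (2 * c) • u := by
    ext i; simp; ring
  have h2 : u ⬝ᵥ (B * Bᵀ) *ᵥ u = Bᵀ *ᵥ u ⬝ᵥ Bᵀ *ᵥ u := by
    rw [← mulVec_mulVec, dotProduct_mulVec, ← mulVec_transpose]
  rw [h1]
  simp only [mulVec_smul, dotProduct_smul, add_dotProduct, smul_dotProduct, smul_eq_mul, h2]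
  rw [dotProduct_comm v, dotProduct_comm w]
  linear_combination (-2 * θ * (Bᵀ *ᵥ u ⬝ᵥ Bᵀ *ᵥ u + (B * Bᵀ) *ᵥ u ⬝ᵥ v)) * hc

lemma frob_eq {p m : ℕ} (B : Matrix (Fin p) (Fin m) ℝ) :
    ∑ i, ∑ j, (B * Bᵀ) i j ^ 2 = ∑ i, ∑ j, (Bᵀ * B) i j ^ 2 := by
  have h : ∀ {k l : ℕ} (A : Matrix (Fin k) (Fin l) ℝ),
      ∑ i, ∑ j, A i j ^ 2 = (A * Aᵀ).trace := by
    intro k l A; simp [Matrix.trace, Matrix.mul_apply, sq]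
  rw [h, h]
  simp only [transpose_mul, transpose_transpose]
  rw [Matrix.mul_assoc, Matrix.trace_mul_comm]
  simp only [Matrix.mul_assoc]

theorem statement12 (p m : ℕ) (B : Matrix (Fin p) (Fin m) ℝ) (σ θ : ℝ)
    (hσ : 0 ≤ σ) (hθ : 0 < θ)
    (μ : Measure ((Fin p → ℝ) × (Fin p → ℝ) × (Fin m → ℝ)))
    (hμ : μ = (Measure.pi fun _ : Fin p => gaussianReal 0 1).prod
      ((Measure.pi fun _ : Fin p => gaussianReal 0 1).prod
        (Measure.pi fun _ : Fin m => gaussianReal 0 1)))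
    (Ξ : (Fin p → ℝ) × (Fin p → ℝ) × (Fin m → ℝ) → ℝ)
    (hΞ : ∀ z, Ξ z = z.1 ⬝ᵥ (B * Bᵀ).mulVec (z.1 - z.2.1)
      + σ * (z.2.2 ⬝ᵥ Bᵀ.mulVec (z.1 - z.2.1)))
    (hint : Integrable (fun z => Real.exp (-θ * Ξ z)) μ) :
    Real.log (∫ z, Real.exp (-θ * Ξ z) ∂μ)
      ≥ θ ^ 2 / 2 * ((∑ i, ∑ j, (Bᵀ * B) i j ^ 2)
          + 2 * σ ^ 2 * ∑ i, ∑ j, B i j ^ 2)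
        - θ * ∑ i, ∑ j, B i j ^ 2 := by
  subst hμ
  set γ := (Measure.pi fun _ : Fin p => gaussianReal 0 1) with hγ
  set δ := (Measure.pi fun _ : Fin m => gaussianReal 0 1) with hδ
  have hT : MeasurePreserving (fun z : (Fin p → ℝ) × (Fin p → ℝ) × (Fin m → ℝ) =>
      MeasurableEquiv.prodAssoc (Prod.map (ContinuousLinearMap.rotation (Real.pi / 4)) id
        (MeasurableEquiv.prodAssoc.symm z))) (γ.prod (γ.prod δ)) (γ.prod (γ.prod δ)) := by
    have h1 := measurePreserving_prodAssoc γ γ δ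
    exact h1.comp (((gauss_rot (Real.pi / 4)).prod (MeasurePreserving.id δ)).comp h1.symm)
  set T := (fun z : (Fin p → ℝ) × (Fin p → ℝ) × (Fin m → ℝ) =>
      MeasurableEquiv.prodAssoc (Prod.map (ContinuousLinearMap.rotation (Real.pi / 4)) id
        (MeasurableEquiv.prodAssoc.symm z))) with hTdef
  set c : ℝ := Real.cos (Real.pi / 4) with hcdef
  have hc : c * c = 1 / 2 := by
    rw [hcdef, Real.cos_pi_div_four]
    nlinarith [Real.mul_self_sqrt (show (0 : ℝ) ≤ 2 by norm_num)]
  have hTz : ∀ z, -θ * Ξ (T z) = -θ * (Bᵀ *ᵥ z.1 ⬝ᵥ Bᵀ *ᵥ z.1)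
      + ((-θ) • ((B * Bᵀ) *ᵥ z.1) ⬝ᵥ z.2.1
      + (-(2 * θ * σ * c)) • (Bᵀ *ᵥ z.1) ⬝ᵥ z.2.2) := by
    rintro ⟨u, v, w⟩
    have hTe : T (u, v, w) = (c • u + c • v, -c • u + c • v, w) := by
      have hs : Real.sin (Real.pi / 4) = c := by
        rw [hcdef, Real.cos_pi_div_four, Real.sin_pi_div_four]
      simp only [hTdef]
      rw [show (MeasurableEquiv.prodAssoc.symm (u, v, w)) = ((u, v), w) from rfl]
      rw [Prod.map_apply, ContinuousLinearMap.rotation_apply, hs]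
      rfl
    rw [hΞ, hTe]
    exact quad_id B σ θ c hc u v w
  have hint2 : Integrable (fun z => Real.exp (-θ * Ξ (T z))) (γ.prod (γ.prod δ)) :=
    hT.integrable_comp_of_integrable hint
  have hI : ∫ z, Real.exp (-θ * Ξ z) ∂(γ.prod (γ.prod δ))
      = ∫ z, Real.exp (-θ * Ξ (T z)) ∂(γ.prod (γ.prod δ)) := by
    rw [← integral_map (φ := T) (f := fun z => Real.exp (-θ * Ξ z)) hT.measurable.aemeasurable
      (by rw [hT.map_eq]; exact hint.aestronglyMeasurable), hT.map_eq]
  let h : (Fin p → ℝ) → ℝ := fun u => -θ * (Bᵀ *ᵥ u ⬝ᵥ Bᵀ *ᵥ u)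
    + (θ ^ 2 / 2 * ((B * Bᵀ) *ᵥ u ⬝ᵥ (B * Bᵀ) *ᵥ u) + θ ^ 2 * σ ^ 2 * (Bᵀ *ᵥ u ⬝ᵥ Bᵀ *ᵥ u))
  have hinner : ∀ u, ∫ y, Real.exp (-θ * Ξ (T (u, y))) ∂(γ.prod δ) = Real.exp (h u) := by
    intro u
    simp_rw [hTz, Real.exp_add]
    rw [integral_const_mul, integral_prod_mul (μ := γ) (ν := δ)
      (fun v => Real.exp ((-θ) • ((B * Bᵀ) *ᵥ u) ⬝ᵥ v))
      (fun w => Real.exp ((-(2 * θ * σ * c)) • (Bᵀ *ᵥ u) ⬝ᵥ w)), hγ, hδ,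
      gauss_pi_exp, gauss_pi_exp, ← Real.exp_add, ← Real.exp_add]
    congr 1
    simp only [h, smul_dotProduct, dotProduct_smul, smul_eq_mul]
    linear_combination (2 * θ ^ 2 * σ ^ 2 * (Bᵀ *ᵥ u ⬝ᵥ Bᵀ *ᵥ u)) * hc
  have hexp : Integrable (fun u => Real.exp (h u)) γ := by
    have := hint2.integral_prod_left
    simpa only [hinner] using this
  have hI2 : ∫ z, Real.exp (-θ * Ξ (T z)) ∂(γ.prod (γ.prod δ)) = ∫ u, Real.exp (h u) ∂γ := by
    rw [integral_prod _ hint2]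
    simp only [hinner]
  obtain ⟨q1, e1⟩ := gauss_pi_quad Bᵀ
  obtain ⟨q2, e2⟩ := gauss_pi_quad (B * Bᵀ)
  have hh : Integrable h γ :=
    (q1.const_mul _).add ((q2.const_mul _).add (q1.const_mul _))
  have hhe : ∫ u, h u ∂γ = θ ^ 2 / 2 * ((∑ i, ∑ j, (Bᵀ * B) i j ^ 2)
          + 2 * σ ^ 2 * ∑ i, ∑ j, B i j ^ 2)
        - θ * ∑ i, ∑ j, B i j ^ 2 := by
    simp only [h]
    rw [← hγ] at q1 q2 e1 e2
    have i1 := integral_add (q1.const_mul (-θ))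
      ((q2.const_mul (θ ^ 2 / 2)).add (q1.const_mul (θ ^ 2 * σ ^ 2)))
    have i2 := integral_add (q2.const_mul (θ ^ 2 / 2)) (q1.const_mul (θ ^ 2 * σ ^ 2))
    simp only [Pi.add_apply] at i1
    rw [i1, i2, integral_const_mul, integral_const_mul, integral_const_mul, e1, e2, frob_eq]
    have : ∑ i, ∑ j, Bᵀ i j ^ 2 = ∑ i, ∑ j, B i j ^ 2 := by
      rw [Finset.sum_comm]; rfl
    rw [this]; ring
  have hJ : Real.exp (∫ u, h u ∂γ) ≤ ∫ u, Real.exp (h u) ∂γ :=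
    convexOn_exp.map_integral_le (μ := γ) Real.continuous_exp.continuousOn isClosed_univ
      (by simp) hh hexp
  rw [hI, hI2, ← hhe]
  exact (Real.le_log_iff_exp_le (lt_of_lt_of_le (Real.exp_pos _) hJ)).2 hJ
end
end

section
/- Let X ∈ R^{n×p} have i.i.d. standard normal entries with rows X₁,…,X_n, let B be a fixed p×m matrix, and fix distinct indices 1 and 2. Then E[‖X(X₁ − X₂)‖₂² · ‖B^T X₁‖₂²] = 2[(p+2)(p+3) + (n−2)(p+1)]·‖B‖_F². -/
open MeasureTheory ProbabilityTheory Matrix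

noncomputable section

/-- Moments of all orders. -/
def AllLp {Ω : Type*} [MeasurableSpace Ω] (μ : Measure Ω) (f : Ω → ℝ) : Prop :=
  ∀ q : NNReal, MemLp f q μ

namespace AllLp
variable {Ω Ω' : Type*} [MeasurableSpace Ω] [MeasurableSpace Ω'] {μ : Measure Ω}
  {ν : Measure Ω'}

theorem integrable {f : Ω → ℝ} (hf : AllLp μ f) : Integrable f μ := by
  have := hf 1
  exact memLp_one_iff_integrable.1 (by simpa using this)

theorem const [IsFiniteMeasure μ] (c : ℝ) : AllLp μ (fun _ => c) := fun _ => memLp_const c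

theorem add {f g : Ω → ℝ} (hf : AllLp μ f) (hg : AllLp μ g) :
    AllLp μ (fun x => f x + g x) := fun q => (hf q).add (hg q)

theorem sub {f g : Ω → ℝ} (hf : AllLp μ f) (hg : AllLp μ g) :
    AllLp μ (fun x => f x - g x) := fun q => (hf q).sub (hg q)

theorem mul {f g : Ω → ℝ} (hf : AllLp μ f) (hg : AllLp μ g) :
    AllLp μ (fun x => f x * g x) := by
  intro q
  have h : ENNReal.HolderTriple ((2 * q : NNReal) : ENNReal) ((2 * q : NNReal) : ENNReal) q := by
    constructor
    by_cases hq : q = 0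
    · simp [hq]
    · rw [← ENNReal.coe_inv (by positivity), ← ENNReal.coe_inv hq, ← ENNReal.coe_add]
      congr 1
      field_simp
      norm_num
  exact (hg (2 * q)).mul (hf (2 * q))

theorem pow [IsFiniteMeasure μ] {f : Ω → ℝ} (hf : AllLp μ f) (k : ℕ) :
    AllLp μ (fun x => f x ^ k) := by
  induction k with
  | zero => simpa using const (μ := μ) 1
  | succ k ih => simpa [pow_succ] using ih.mul hf

theorem sum {ι : Type*} {s : Finset ι} {f : ι → Ω → ℝ} (hf : ∀ i, AllLp μ (f i)) :
    AllLp μ (fun x => ∑ i ∈ s, f i x) := fun q => memLp_finsetSum s (fun i _ => hf i q)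

theorem dot {p : ℕ} {f g : Ω → Fin p → ℝ} (hf : ∀ i, AllLp μ (fun x => f x i))
    (hg : ∀ i, AllLp μ (fun x => g x i)) : AllLp μ (fun x => f x ⬝ᵥ g x) := by
  unfold dotProduct
  exact sum fun i => (hf i).mul (hg i)

theorem comp {f : Ω' → ℝ} {g : Ω → Ω'} (hf : AllLp ν f) (hg : MeasurePreserving g μ ν) :
    AllLp μ (fun x => f (g x)) := fun q => (hf q).comp_measurePreserving hg

end AllLp

abbrev gam (p : ℕ) : Measure (Fin p → ℝ) := Measure.pi fun _ : Fin p => gaussianReal 0 1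

theorem allLp_gauss : AllLp (gaussianReal 0 1) (fun x => x) := fun q => memLp_id_gaussianReal q

theorem allLp_gam {p : ℕ} (i : Fin p) : AllLp (gam p) (fun u => u i) :=
  allLp_gauss.comp (measurePreserving_eval (fun _ : Fin p => gaussianReal 0 1) i)

theorem moment_aux (n : ℕ) : ∫ x, x ^ n ∂(gaussianReal 0 1) =
    iteratedDeriv n (fun t : ℝ => Real.exp (t ^ 2 / 2)) 0 := by
  have h := iteratedDeriv_mgf_zero (X := fun x : ℝ => x) (μ := gaussianReal 0 1)
    (by
      have : integrableExpSet (fun x : ℝ => x) (gaussianReal 0 1) = Set.univ :=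
        integrableExpSet_id_gaussianReal
      simp [this]) n
  rw [mgf_fun_id_gaussianReal] at h
  simpa using h.symm

theorem deriv_aux (n : ℕ) (q q' : ℝ → ℝ) (hq : ∀ t, HasDerivAt q (q' t) t)
    (h : iteratedDeriv n (fun t : ℝ => Real.exp (t ^ 2 / 2)) =
      fun t => q t * Real.exp (t ^ 2 / 2)) :
    iteratedDeriv (n + 1) (fun t : ℝ => Real.exp (t ^ 2 / 2)) =
      fun t => (q' t + t * q t) * Real.exp (t ^ 2 / 2) := by
  rw [iteratedDeriv_succ, h]
  funext t
  have h1 : HasDerivAt (fun t : ℝ => t ^ 2 / 2) t t := by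
    exact ((hasDerivAt_pow 2 t).div_const 2).congr_deriv (by norm_num)
  refine ((hq t).mul h1.exp).deriv.trans ?_
  ring

theorem gmoments : (∫ x, x ^ 2 ∂(gaussianReal 0 1) = 1) ∧ (∫ x, x ^ 4 ∂(gaussianReal 0 1) = 3) ∧
    (∫ x, x ^ 6 ∂(gaussianReal 0 1) = 15) := by
  have e0 : iteratedDeriv 0 (fun t : ℝ => Real.exp (t ^ 2 / 2)) =
      fun t => (fun _ => 1 : ℝ → ℝ) t * Real.exp (t ^ 2 / 2) := by simp
  have dp (k : ℕ) (t : ℝ) : HasDerivAt (fun t : ℝ => t ^ k) (k * t ^ (k - 1)) t := hasDerivAt_pow k t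
  have e1 := deriv_aux _ _ (fun _ => 0) (fun t => hasDerivAt_const t 1) e0
  have e2 := deriv_aux _ (fun t => t) (fun _ => 1) (fun t => hasDerivAt_id t)
    (by rw [e1]; funext t; ring)
  have e3 := deriv_aux _ (fun t => t ^ 2 + 1) (fun t => 2 * t)
    (fun t => ((dp 2 t).add_const 1).congr_deriv (by norm_num)) (by rw [e2]; funext t; ring)
  have e4 := deriv_aux _ (fun t => t ^ 3 + 3 * t ^ 1) (fun t => 3 * t ^ 2 + 3)
    (fun t => ((dp 3 t).add ((dp 1 t).const_mul 3)).congr_deriv (by norm_num))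
    (by rw [e3]; funext t; ring)
  have e5 := deriv_aux _ (fun t => t ^ 4 + 6 * t ^ 2 + 3) (fun t => 4 * t ^ 3 + 12 * t)
    (fun t => (((dp 4 t).add ((dp 2 t).const_mul 6)).add_const 3).congr_deriv
      (by norm_num; ring))
    (by rw [e4]; funext t; ring)
  have e6 := deriv_aux _ (fun t => t ^ 5 + 10 * t ^ 3 + 15 * t ^ 1)
    (fun t => 5 * t ^ 4 + 30 * t ^ 2 + 15)
    (fun t => (((dp 5 t).add ((dp 3 t).const_mul 10)).add ((dp 1 t).const_mul 15)).congr_deriv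
      (by norm_num; ring))
    (by rw [e5]; funext t; ring)
  simp only [moment_aux]
  norm_num at e2 e4 e6
  rw [e2, e4, e6]
  norm_num

theorem allLp_S (p : ℕ) : AllLp (gam p) (fun u => u ⬝ᵥ u) :=
  AllLp.dot allLp_gam allLp_gam

theorem integral_gam_succ {p : ℕ} (i : Fin (p + 1)) (k : ℕ) :
    ∫ u, u i ^ 2 * (u ⬝ᵥ u) ^ k ∂(gam (p + 1)) =
      ∫ z, z.1 ^ 2 * (z.1 ^ 2 + z.2 ⬝ᵥ z.2) ^ k ∂((gaussianReal 0 1).prod (gam p)) := by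
  have h := measurePreserving_piFinSuccAbove (fun _ : Fin (p + 1) => gaussianReal 0 1) i
  rw [← h.integral_comp (MeasurableEquiv.measurableEmbedding _)]
  congr 1
  funext u
  simp only [dotProduct]
  rw [Fin.sum_univ_succAbove _ i]
  simp [MeasurableEquiv.piFinSuccAbove, Fin.insertNthEquiv, Fin.removeNth, pow_two]

theorem allLp_mix {p : ℕ} (k l : ℕ) : AllLp ((gaussianReal 0 1).prod (gam p))
    (fun z => z.1 ^ k * (z.2 ⬝ᵥ z.2) ^ l) :=
  ((allLp_gauss.comp measurePreserving_fst).pow k).mul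
    (((allLp_S p).comp measurePreserving_snd).pow l)

theorem int_mix {p : ℕ} (k l : ℕ) : ∫ z, z.1 ^ k * (z.2 ⬝ᵥ z.2) ^ l
      ∂((gaussianReal 0 1).prod (gam p)) =
    (∫ x, x ^ k ∂(gaussianReal 0 1)) * ∫ y, (y ⬝ᵥ y) ^ l ∂(gam p) :=
  integral_prod_mul (fun x : ℝ => x ^ k) (fun y : Fin p → ℝ => (y ⬝ᵥ y) ^ l)

theorem int_S_of {p : ℕ} (k : ℕ) (c : ℝ)
    (h : ∀ i, ∫ u, u i ^ 2 * (u ⬝ᵥ u) ^ k ∂(gam p) = c) :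
    ∫ u, (u ⬝ᵥ u) ^ (k + 1) ∂(gam p) = p * c := by
  have : ∀ u : Fin p → ℝ, (u ⬝ᵥ u) ^ (k + 1) = ∑ i, u i ^ 2 * (u ⬝ᵥ u) ^ k := by
    intro u
    rw [← Finset.sum_mul, pow_succ, mul_comm]
    simp [dotProduct, pow_two]
  simp_rw [this]
  rw [integral_finsetSum _ fun i _ => (((allLp_gam i).pow 2).mul ((allLp_S p).pow k)).integrable]
  simp [h]

theorem D0 {p : ℕ} (i : Fin p) : ∫ u, u i ^ 2 * (u ⬝ᵥ u) ^ 0 ∂(gam p) = 1 := by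
  cases p with
  | zero => exact i.elim0
  | succ p =>
    rw [integral_gam_succ]
    have := int_mix (p := p) 2 0
    simp only [pow_zero] at this ⊢
    rw [this, gmoments.1]; simp

theorem S1 (p : ℕ) : ∫ u, (u ⬝ᵥ u) ^ 1 ∂(gam p) = p := by
  rw [int_S_of 0 1 D0, mul_one]

theorem D1 {p : ℕ} (i : Fin p) : ∫ u, u i ^ 2 * (u ⬝ᵥ u) ^ 1 ∂(gam p) = p + 2 := by
  cases p with
  | zero => exact i.elim0
  | succ p =>
    rw [integral_gam_succ]
    have : ∀ z : ℝ × (Fin p → ℝ), z.1 ^ 2 * (z.1 ^ 2 + z.2 ⬝ᵥ z.2) ^ 1 =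
      z.1 ^ 4 * (z.2 ⬝ᵥ z.2) ^ 0 + z.1 ^ 2 * (z.2 ⬝ᵥ z.2) ^ 1 := by intro z; ring
    simp_rw [this]
    rw [integral_add (allLp_mix 4 0).integrable (allLp_mix 2 1).integrable, int_mix, int_mix,
      gmoments.1, gmoments.2.1, S1]
    simp; ring

theorem S2 (p : ℕ) : ∫ u, (u ⬝ᵥ u) ^ 2 ∂(gam p) = p * (p + 2) := int_S_of 1 _ D1

theorem D2 {p : ℕ} (i : Fin p) :
    ∫ u, u i ^ 2 * (u ⬝ᵥ u) ^ 2 ∂(gam p) = (p + 2) * (p + 4) := by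
  cases p with
  | zero => exact i.elim0
  | succ p =>
    rw [integral_gam_succ]
    have : ∀ z : ℝ × (Fin p → ℝ), z.1 ^ 2 * (z.1 ^ 2 + z.2 ⬝ᵥ z.2) ^ 2 =
      (z.1 ^ 6 * (z.2 ⬝ᵥ z.2) ^ 0 + 2 * (z.1 ^ 4 * (z.2 ⬝ᵥ z.2) ^ 1))
        + z.1 ^ 2 * (z.2 ⬝ᵥ z.2) ^ 2 := by intro z; ring
    simp_rw [this]
    rw [integral_add ((allLp_mix 6 0).add ((AllLp.const 2).mul (allLp_mix 4 1))).integrable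
        (allLp_mix 2 2).integrable,
      integral_add (allLp_mix 6 0).integrable ((AllLp.const 2).mul (allLp_mix 4 1)).integrable,
      integral_const_mul, int_mix, int_mix, int_mix,
      gmoments.1, gmoments.2.1, gmoments.2.2, S1, S2]
    simp; ring

theorem gneg : MeasurePreserving (fun x : ℝ => -x) (gaussianReal 0 1) (gaussianReal 0 1) :=
  ⟨measurable_neg, by rw [gaussianReal_map_neg]; simp⟩

theorem O_k {p : ℕ} (i j : Fin p) (hij : i ≠ j) (k : ℕ) :
    ∫ u, u i * u j * (u ⬝ᵥ u) ^ k ∂(gam p) = 0 := by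
  let e : ∀ l : Fin p, ℝ ≃ᵐ ℝ := fun l => if l = i then MeasurableEquiv.neg ℝ else
    MeasurableEquiv.refl ℝ
  have he : ∀ l x, e l x = if l = i then -x else x := by
    intro l x; by_cases h : l = i <;> simp [e, h]
  have h : MeasurePreserving (fun (u : Fin p → ℝ) l => e l (u l)) (gam p) (gam p) := by
    apply measurePreserving_pi
    intro l
    by_cases h : l = i
    · simpa [e, h] using gneg
    · simp only [e, h, if_false]
      exact MeasurePreserving.id (gaussianReal 0 1)
  have h2 := h.integral_comp (MeasurableEquiv.piCongrRight e).measurableEmbedding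
    (fun u => u i * u j * (u ⬝ᵥ u) ^ k)
  have h3 : ∀ u : Fin p → ℝ, (fun l => e l (u l)) ⬝ᵥ (fun l => e l (u l)) = u ⬝ᵥ u := by
    intro u
    simp only [dotProduct, he]
    refine Finset.sum_congr rfl fun l _ => ?_
    split_ifs <;> ring
  simp only [h3] at h2
  simp only [he, if_true, hij.symm, if_false] at h2
  simp only [neg_mul, integral_neg] at h2
  linarith

theorem Q_k {p : ℕ} (k : ℕ) (D : ℝ) (h : ∀ i, ∫ u, u i ^ 2 * (u ⬝ᵥ u) ^ k ∂(gam p) = D)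
    (c : Fin p → ℝ) : ∫ u, (c ⬝ᵥ u) ^ 2 * (u ⬝ᵥ u) ^ k ∂(gam p) = c ⬝ᵥ c * D := by
  have : ∀ u : Fin p → ℝ, (c ⬝ᵥ u) ^ 2 * (u ⬝ᵥ u) ^ k =
      ∑ i, ∑ j, c i * c j * (u i * u j * (u ⬝ᵥ u) ^ k) := by
    intro u
    rw [pow_two]
    conv_lhs => rw [dotProduct, Finset.sum_mul_sum, Finset.sum_mul]
    refine Finset.sum_congr rfl fun i _ => ?_
    rw [Finset.sum_mul]
    refine Finset.sum_congr rfl fun j _ => ?_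
    ring
  simp_rw [this]
  have hI : ∀ i j, AllLp (gam p) (fun u => c i * c j * (u i * u j * (u ⬝ᵥ u) ^ k)) :=
    fun i j => (AllLp.const _).mul (((allLp_gam i).mul (allLp_gam j)).mul ((allLp_S p).pow k))
  rw [integral_finsetSum _ fun i _ => (AllLp.sum (hI i)).integrable, dotProduct, Finset.sum_mul]
  refine Finset.sum_congr rfl fun i _ => ?_
  rw [integral_finsetSum _ fun j _ => (hI i j).integrable, Finset.sum_eq_single i]
  · rw [integral_const_mul, ← h i]; simp only [pow_two]
  · intro j _ hj
    rw [integral_const_mul, O_k i j hj.symm, mul_zero]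
  · simp

theorem odd_zero {p : ℕ} (f : (Fin p → ℝ) → ℝ) (hf : ∀ u, f (-u) = - f u) :
    ∫ u, f u ∂(gam p) = 0 := by
  have h : MeasurePreserving (fun (u : Fin p → ℝ) l => - (u l)) (gam p) (gam p) :=
    measurePreserving_pi _ _ (fun l => gneg)
  have h2 := h.integral_comp (MeasurableEquiv.neg (Fin p → ℝ)).measurableEmbedding f
  have : ∀ u : Fin p → ℝ, f (fun l => - u l) = - f u := hf
  simp only [this, integral_neg] at h2
  linarith

theorem lin2 {p : ℕ} (w : Fin p → ℝ) : ∫ v, (v ⬝ᵥ w) ^ 2 ∂(gam p) = w ⬝ᵥ w := by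
  have := Q_k 0 1 D0 w
  simpa [dotProduct_comm] using this

theorem allLp_lin {p : ℕ} (w : Fin p → ℝ) : AllLp (gam p) (fun v => v ⬝ᵥ w) :=
  AllLp.dot allLp_gam (fun _ => AllLp.const _)

theorem allLp_lin' {p : ℕ} (w : Fin p → ℝ) : AllLp (gam p) (fun v => w ⬝ᵥ v) :=
  AllLp.dot (fun _ => AllLp.const _) allLp_gam

/-- The weight. -/
def Wt {p m : ℕ} (B : Matrix (Fin p) (Fin m) ℝ) (u : Fin p → ℝ) : ℝ :=
  ∑ j, (Bᵀ.mulVec u j) ^ 2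

theorem allLp_W {p m : ℕ} (B : Matrix (Fin p) (Fin m) ℝ) : AllLp (gam p) (Wt B) := by
  exact AllLp.sum fun j => (allLp_lin' (fun i => B i j)).pow 2

theorem int_W {p m : ℕ} (B : Matrix (Fin p) (Fin m) ℝ) (k : ℕ) (D : ℝ)
    (h : ∀ i, ∫ u, u i ^ 2 * (u ⬝ᵥ u) ^ k ∂(gam p) = D) :
    ∫ u, (u ⬝ᵥ u) ^ k * Wt B u ∂(gam p) = D * ∑ i, ∑ j, B i j ^ 2 := by
  have : ∀ u : Fin p → ℝ, (u ⬝ᵥ u) ^ k * Wt B u =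
      ∑ j, ((fun i => B i j) ⬝ᵥ u) ^ 2 * (u ⬝ᵥ u) ^ k := by
    intro u
    rw [← Finset.sum_mul, mul_comm]; rfl
  simp_rw [this]
  rw [integral_finsetSum _ fun j _ => (((allLp_lin' (fun i => B i j)).pow 2).mul
    ((allLp_S p).pow k)).integrable]
  simp_rw [Q_k k D h]
  rw [← Finset.sum_mul, mul_comm, Finset.sum_comm]
  simp [dotProduct, pow_two]

section rows
variable {n p m : ℕ} (B : Matrix (Fin p) (Fin m) ℝ)

theorem inner_a (u : Fin p → ℝ) : ∫ v, (u ⬝ᵥ (u - v)) ^ 2 ∂(gam p) =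
    (u ⬝ᵥ u) ^ 2 + (u ⬝ᵥ u) ^ 1 := by
  have : ∀ v, (u ⬝ᵥ (u - v)) ^ 2 = ((u ⬝ᵥ u) ^ 2 - 2 * (u ⬝ᵥ u) * (v ⬝ᵥ u)) + (v ⬝ᵥ u) ^ 2 := by
    intro v; rw [dotProduct_sub, dotProduct_comm u v]; ring
  simp_rw [this]
  have h1 := (AllLp.const (μ := gam p) (2 * (u ⬝ᵥ u))).mul (allLp_lin u)
  rw [integral_add ((AllLp.const _).sub h1).integrable ((allLp_lin u).pow 2).integrable,
    integral_sub (AllLp.const _).integrable h1.integrable, integral_const_mul,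
    odd_zero (fun v => v ⬝ᵥ u) (by simp), lin2]
  simp

theorem inner_b (u : Fin p → ℝ) : ∫ v, (v ⬝ᵥ (u - v)) ^ 2 ∂(gam p) =
    (u ⬝ᵥ u) ^ 1 + p * (p + 2) * (u ⬝ᵥ u) ^ 0 := by
  have : ∀ v, (v ⬝ᵥ (u - v)) ^ 2 = ((v ⬝ᵥ u) ^ 2 - 2 * ((v ⬝ᵥ u) * (v ⬝ᵥ v))) + (v ⬝ᵥ v) ^ 2 := by
    intro v; rw [dotProduct_sub]; ring
  simp_rw [this]
  have h1 := (AllLp.const (μ := gam p) 2).mul ((allLp_lin u).mul (allLp_S p))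
  rw [integral_add (((allLp_lin u).pow 2).sub h1).integrable ((allLp_S p).pow 2).integrable,
    integral_sub ((allLp_lin u).pow 2).integrable h1.integrable, integral_const_mul,
    odd_zero (fun v => (v ⬝ᵥ u) * (v ⬝ᵥ v)) (by simp), lin2, S2]
  simp

theorem inner_c (u : Fin p → ℝ) : ∫ v, (u - v) ⬝ᵥ (u - v) ∂(gam p) =
    (u ⬝ᵥ u) ^ 1 + p * (u ⬝ᵥ u) ^ 0 := by
  have : ∀ v, (u - v) ⬝ᵥ (u - v) = (u ⬝ᵥ u - 2 * (v ⬝ᵥ u)) + (v ⬝ᵥ v) ^ 1 := by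
    intro v; rw [dotProduct_sub, sub_dotProduct, sub_dotProduct, dotProduct_comm u v]; ring
  simp_rw [this]
  have h1 := (AllLp.const (μ := gam p) 2).mul (allLp_lin u)
  rw [integral_add ((AllLp.const _).sub h1).integrable ((allLp_S p).pow 1).integrable,
    integral_sub (AllLp.const _).integrable h1.integrable, integral_const_mul,
    odd_zero (fun v => v ⬝ᵥ u) (by simp), S1]
  simp

theorem mp_pair (a b : Fin n) (hab : a ≠ b) :
    MeasurePreserving (fun X : Fin n → Fin p → ℝ => (X a, X b))
      (Measure.pi fun _ => gam p) ((gam p).prod (gam p)) := by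
  refine ⟨by fun_prop, ?_⟩
  have h := (iIndepFun_pi (μ := fun _ : Fin n => gam p) (X := fun _ x => x)
    (fun _ => aemeasurable_id)).indepFun hab
  have h2 := (indepFun_iff_map_prod_eq_prod_map_map
    (Measurable.aemeasurable (by fun_prop)) (Measurable.aemeasurable (by fun_prop))).1 h
  rw [h2]
  congr 1
  · exact (measurePreserving_eval (fun _ : Fin n => gam p) a).map_eq
  · exact (measurePreserving_eval (fun _ : Fin n => gam p) b).map_eq

theorem mp_triple (a b s : Fin n) (hab : a ≠ b) (has : a ≠ s) (hbs : b ≠ s) :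
    MeasurePreserving (fun X : Fin n → Fin p → ℝ => ((X a, X b), X s))
      (Measure.pi fun _ => gam p) (((gam p).prod (gam p)).prod (gam p)) := by
  refine ⟨by fun_prop, ?_⟩
  have h := (iIndepFun_pi (μ := fun _ : Fin n => gam p) (X := fun _ x => x)
    (fun _ => aemeasurable_id)).indepFun_prodMk (fun i => by fun_prop) a b s has hbs
  have h2 := (indepFun_iff_map_prod_eq_prod_map_map
    (Measurable.aemeasurable (by fun_prop)) (Measurable.aemeasurable (by fun_prop))).1 h
  rw [h2]
  congr 1
  · exact (mp_pair a b hab).map_eq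
  · exact (measurePreserving_eval (fun _ : Fin n => gam p) s).map_eq

theorem mp_integral {Ω Ω' : Type*} [MeasurableSpace Ω] [MeasurableSpace Ω'] {μ : Measure Ω}
    {ν : Measure Ω'} {g : Ω → Ω'} (hg : MeasurePreserving g μ ν) {f : Ω' → ℝ} (hf : AllLp ν f) :
    ∫ x, f (g x) ∂μ = ∫ y, f y ∂ν := by
  rw [← hg.map_eq, integral_map hg.measurable.aemeasurable]
  rw [hg.map_eq]; exact hf.integrable.aestronglyMeasurable

theorem l1 (i : Fin p) : AllLp ((gam p).prod (gam p)) (fun z => z.1 i) :=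
  (allLp_gam i).comp measurePreserving_fst
theorem l2 (i : Fin p) : AllLp ((gam p).prod (gam p)) (fun z => z.2 i) :=
  (allLp_gam i).comp measurePreserving_snd
theorem lW : AllLp ((gam p).prod (gam p)) (fun z => Wt B z.1) :=
  (allLp_W B).comp measurePreserving_fst
theorem lT : AllLp (((gam p).prod (gam p)).prod (gam p))
    (fun z => (z.2 ⬝ᵥ (z.1.1 - z.1.2)) ^ 2 * Wt B z.1.1) :=
  ((AllLp.dot (fun i => (allLp_gam i).comp measurePreserving_snd) (fun i =>
    ((l1 i).sub (l2 i)).comp measurePreserving_fst)).pow 2).mul ((lW B).comp measurePreserving_fst)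

theorem lSW (k : ℕ) : AllLp (gam p) (fun u => (u ⬝ᵥ u) ^ k * Wt B u) :=
  ((allLp_S p).pow k).mul (allLp_W B)

theorem term_a (a b : Fin n) (hab : a ≠ b) :
    ∫ X : Fin n → Fin p → ℝ, (X a ⬝ᵥ (X a - X b)) ^ 2 * Wt B (X a) ∂(Measure.pi fun _ => gam p)
    = ((p + 2) * (p + 4) + (p + 2)) * ∑ i, ∑ j, B i j ^ 2 := by
  have hf : AllLp ((gam p).prod (gam p)) (fun z => (z.1 ⬝ᵥ (z.1 - z.2)) ^ 2 * Wt B z.1) :=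
    ((AllLp.dot l1 (fun i => (l1 i).sub (l2 i))).pow 2).mul (lW B)
  rw [mp_integral (mp_pair a b hab) hf, integral_prod _ hf.integrable]
  simp only [integral_mul_const, inner_a, add_mul]
  rw [integral_add (lSW B 2).integrable (lSW B 1).integrable, int_W B 2 _ D2, int_W B 1 _ D1]
  ring

theorem term_b (a b : Fin n) (hab : a ≠ b) :
    ∫ X : Fin n → Fin p → ℝ, (X b ⬝ᵥ (X a - X b)) ^ 2 * Wt B (X a) ∂(Measure.pi fun _ => gam p)
    = ((p + 2) + p * (p + 2)) * ∑ i, ∑ j, B i j ^ 2 := by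
  have hf : AllLp ((gam p).prod (gam p)) (fun z => (z.2 ⬝ᵥ (z.1 - z.2)) ^ 2 * Wt B z.1) :=
    ((AllLp.dot l2 (fun i => (l1 i).sub (l2 i))).pow 2).mul (lW B)
  rw [mp_integral (mp_pair a b hab) hf, integral_prod _ hf.integrable]
  simp only [integral_mul_const, inner_b]
  have : ∀ u : Fin p → ℝ, ((u ⬝ᵥ u) ^ 1 + p * (p + 2) * (u ⬝ᵥ u) ^ 0) * Wt B u =
    (u ⬝ᵥ u) ^ 1 * Wt B u + p * (p + 2) * ((u ⬝ᵥ u) ^ 0 * Wt B u) := by intro u; ring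
  simp_rw [this]
  rw [integral_add (lSW B 1).integrable ((AllLp.const _).mul (lSW B 0)).integrable,
    integral_const_mul, int_W B 1 _ D1, int_W B 0 _ D0]
  ring

theorem term_c (a b s : Fin n) (hab : a ≠ b) (has : a ≠ s) (hbs : b ≠ s) :
    ∫ X : Fin n → Fin p → ℝ, (X s ⬝ᵥ (X a - X b)) ^ 2 * Wt B (X a) ∂(Measure.pi fun _ => gam p)
    = ((p + 2) + p) * ∑ i, ∑ j, B i j ^ 2 := by
  rw [mp_integral (mp_triple a b s hab has hbs) (lT B), integral_prod _ (lT B).integrable]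
  simp only [integral_mul_const, lin2]
  have hf : AllLp ((gam p).prod (gam p)) (fun z => ((z.1 - z.2) ⬝ᵥ (z.1 - z.2)) * Wt B z.1) :=
    (AllLp.dot (fun i => (l1 i).sub (l2 i)) (fun i => (l1 i).sub (l2 i))).mul (lW B)
  rw [integral_prod _ hf.integrable]
  simp only [integral_mul_const, inner_c]
  have : ∀ u : Fin p → ℝ, ((u ⬝ᵥ u) ^ 1 + p * (u ⬝ᵥ u) ^ 0) * Wt B u =
    (u ⬝ᵥ u) ^ 1 * Wt B u + p * ((u ⬝ᵥ u) ^ 0 * Wt B u) := by intro u; ring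
  simp_rw [this]
  rw [integral_add (lSW B 1).integrable ((AllLp.const _).mul (lSW B 0)).integrable,
    integral_const_mul, int_W B 1 _ D1, int_W B 0 _ D0]
  ring

end rows

theorem statement13 (n p m : ℕ) (hn : 2 ≤ n) (B : Matrix (Fin p) (Fin m) ℝ)
    (a b : Fin n) (hab : a ≠ b) :
    ∫ X : Fin n → Fin p → ℝ,
      (∑ s, (X s ⬝ᵥ (X a - X b)) ^ 2) * (∑ j, (Bᵀ.mulVec (X a) j) ^ 2)
      ∂(Measure.pi fun _ : Fin n => Measure.pi fun _ : Fin p => gaussianReal 0 1)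
    = 2 * (((p : ℝ) + 2) * ((p : ℝ) + 3) + ((n : ℝ) - 2) * ((p : ℝ) + 1))
      * ∑ i, ∑ j, B i j ^ 2 := by
  have hrow : ∀ (s : Fin n) (i : Fin p),
      AllLp (Measure.pi fun _ : Fin n => gam p) (fun X => X s i) := fun s i =>
    (allLp_gam i).comp (measurePreserving_eval (fun _ : Fin n => gam p) s)
  have hI : ∀ s : Fin n, AllLp (Measure.pi fun _ : Fin n => gam p)
      (fun X => (X s ⬝ᵥ (X a - X b)) ^ 2 * Wt B (X a)) := fun s =>
    ((AllLp.dot (hrow s) (fun i => (hrow a i).sub (hrow b i))).pow 2).mul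
      ((allLp_W B).comp (measurePreserving_eval (fun _ : Fin n => gam p) a))
  change ∫ X : Fin n → Fin p → ℝ, (∑ s, (X s ⬝ᵥ (X a - X b)) ^ 2) * Wt B (X a)
    ∂(Measure.pi fun _ : Fin n => gam p) = _
  simp_rw [Finset.sum_mul]
  rw [integral_finsetSum _ fun s _ => (hI s).integrable]
  rw [← Finset.add_sum_erase _ _ (Finset.mem_univ a),
    ← Finset.add_sum_erase _ _ (show b ∈ Finset.univ.erase a by simp [hab.symm]),
    term_a B a b hab, term_b B a b hab,
    Finset.sum_congr rfl (fun s hs => term_c B a b s hab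
      (by simp at hs; exact fun h => hs.2 h.symm) (by simp at hs; exact fun h => hs.1 h.symm))]
  rw [Finset.sum_const, Finset.card_erase_of_mem (by simp [hab.symm]),
    Finset.card_erase_of_mem (by simp), Finset.card_univ, Fintype.card_fin, nsmul_eq_mul]
  have : ((n - 1 - 1 : ℕ) : ℝ) = (n : ℝ) - 2 := by
    rw [Nat.sub_sub, Nat.cast_sub hn]; norm_num
  rw [this]
  ring
end
end
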